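/- Let s ≥ 1 be a real number and let t ∈ [0, 1/2]. Then the inequality I(a,b) < Q_{t,s}(a,b) holds for all distinct positive real numbers a and b if and only if t ≥ 1/2 - 1/(2·√(3s)). -/

import Mathlib

noncomputable def A (a b : ℝ) : ℝ := (a + b) / 2

noncomputable def G (a b : ℝ) : ℝ := Real.sqrt (a * b)

noncomputable def H (a b : ℝ) : ℝ := 2 * a * b / (a + b)

noncomputable def I (a b : ℝ) : ℝ :=
  (1 / Real.exp 1) * (a ^ a / b ^ b) ^ (1 / (a - b))

noncomputable def Q (t s a b : ℝ) : ℝ :=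
  G (t * a + (1 - t) * b) (t * b + (1 - t) * a) ^ s * A a b ^ (1 - s)

noncomputable def f (u s x : ℝ) : ℝ :=
  1 - (1 / (2 * x)) * Real.log ((1 + x) / (1 - x))
    - (1 / 2) * Real.log (1 - x ^ 2) + (s / 2) * Real.log (1 - u * x ^ 2)

noncomputable def h (u s x : ℝ) : ℝ :=
  -x + (1 / 2) * Real.log ((1 + x) / (1 - x)) - s * u * x ^ 3 / (1 - u * x ^ 2)

/-- The function `2x (1 + log (I / A))` for `a, b = A (1 ± x)`. -/
noncomputable def identricAux (x : ℝ) : ℝ :=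
  (1 + x) * Real.log (1 + x) - (1 - x) * Real.log (1 - x)

theorem I_comm {a b : ℝ} (ha : 0 < a) (hb : 0 < b) : I a b = I b a := by
  unfold I
  have hab : 1 / (b - a) = -(1 / (a - b)) := by rw [← neg_sub a b, one_div, one_div, inv_neg]
  have h0 : 0 ≤ a ^ a / b ^ b := by positivity
  rw [hab, Real.rpow_neg (by positivity), ← Real.inv_rpow (by positivity), inv_div]

theorem Q_comm (t s a b : ℝ) : Q t s a b = Q t s b a := by
  unfold Q G A
  rw [mul_comm (t * a + (1 - t) * b), add_comm a b]

theorem I_eq_exp {m x : ℝ} (hm : 0 < m) (hx : 0 < x) (hx1 : x < 1) :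
    I (m * (1 + x)) (m * (1 - x)) = m * Real.exp (identricAux x / (2 * x) - 1) := by
  have hp : 0 < 1 + x := by linarith
  have hn : 0 < 1 - x := by linarith
  have ha : 0 < m * (1 + x) := by positivity
  have hb : 0 < m * (1 - x) := by positivity
  unfold I identricAux
  rw [Real.rpow_def_of_pos ha, Real.rpow_def_of_pos hb, ← Real.exp_sub, ← Real.exp_mul,
    one_div, ← Real.exp_neg, ← Real.exp_add, Real.log_mul hm.ne' hp.ne',
    Real.log_mul hm.ne' hn.ne']
  conv_rhs => rw [← Real.exp_log hm, ← Real.exp_add]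
  congr 1
  have : m * (1 + x) - m * (1 - x) = m * (2 * x) := by ring
  rw [this]
  field_simp
  ring

theorem Q_eq_exp {t s m x : ℝ} (ht : 0 ≤ t) (ht1 : t ≤ 1 / 2) (hm : 0 < m) (hx : 0 < x)
    (hx1 : x < 1) :
    Q t s (m * (1 + x)) (m * (1 - x)) =
      m * Real.exp (s / 2 * Real.log (1 - (1 - 2 * t) ^ 2 * x ^ 2)) := by
  have hw : 0 < 1 - (1 - 2 * t) ^ 2 * x ^ 2 := by
    have : ((1 - 2 * t) * x) ^ 2 < 1 := by
      have h0 : 0 ≤ (1 - 2 * t) * x := mul_nonneg (by linarith) hx.le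
      have h1 : (1 - 2 * t) * x < 1 := by nlinarith
      nlinarith
    linarith [mul_pow (1 - 2 * t) x 2]
  have hA : A (m * (1 + x)) (m * (1 - x)) = m := by unfold A; ring
  have hG : G (t * (m * (1 + x)) + (1 - t) * (m * (1 - x)))
      (t * (m * (1 - x)) + (1 - t) * (m * (1 + x))) =
      m * √(1 - (1 - 2 * t) ^ 2 * x ^ 2) := by
    unfold G
    rw [← Real.sqrt_sq hm.le, ← Real.sqrt_mul (sq_nonneg m), Real.sqrt_sq hm.le]
    congr 1
    ring
  have hs := Real.sqrt_pos.2 hw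
  unfold Q
  rw [hA, hG, Real.mul_rpow hm.le hs.le, mul_right_comm, ← Real.rpow_add hm,
    Real.rpow_def_of_pos hs, Real.log_sqrt hw.le, add_sub_cancel, Real.rpow_one]
  ring_nf

theorem I_lt_Q_iff {t s m x : ℝ} (ht : 0 ≤ t) (ht1 : t ≤ 1 / 2) (hm : 0 < m) (hx : 0 < x)
    (hx1 : x < 1) :
    I (m * (1 + x)) (m * (1 - x)) < Q t s (m * (1 + x)) (m * (1 - x)) ↔
      identricAux x < 2 * x + x * (s * Real.log (1 - (1 - 2 * t) ^ 2 * x ^ 2)) := by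
  rw [I_eq_exp hm hx hx1, Q_eq_exp ht ht1 hm hx hx1, mul_lt_mul_iff_right₀ hm, Real.exp_lt_exp,
    sub_lt_iff_lt_add, div_lt_iff₀ (by positivity)]
  constructor <;> intro h <;> linarith

theorem hasDerivAt_identricAux {x : ℝ} (hx : 0 ≤ x) (hx1 : x < 1) :
    HasDerivAt identricAux (2 + Real.log (1 - x ^ 2)) x := by
  have hp : 1 + x ≠ 0 := by linarith
  have hn : 1 - x ≠ 0 := by linarith
  have h1 : HasDerivAt (fun y : ℝ => 1 + y) 1 x := (hasDerivAt_id x).const_add 1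
  have h2 : HasDerivAt (fun y : ℝ => 1 - y) (-1) x := (hasDerivAt_id x).const_sub 1
  have := (h1.mul (h1.log hp)).sub (h2.mul (h2.log hn))
  refine this.congr_deriv ?_
  rw [show 1 - x ^ 2 = (1 + x) * (1 - x) by ring, Real.log_mul hp hn]
  field_simp
  ring

theorem identricAux_lt {x : ℝ} (hx : 0 < x) (hx1 : x < 1) :
    identricAux x < 2 * x + x * Real.log (1 - x ^ 2 / 3) := by
  set φ : ℝ → ℝ := fun y => 2 * y + y * Real.log (1 - y ^ 2 / 3) - identricAux y with hφ
  have hpos : ∀ y ∈ Set.Ico (0 : ℝ) 1, 0 < 1 - y ^ 2 := by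
    rintro y ⟨h0, h1⟩
    nlinarith
  have hd : ∀ y ∈ Set.Ico (0 : ℝ) 1, HasDerivAt φ
      (Real.log (1 - y ^ 2 / 3) - 2 * y ^ 2 / (3 - y ^ 2) - Real.log (1 - y ^ 2)) y := by
    intro y hy
    have hq := hpos y hy
    have hr : 1 - y ^ 2 / 3 ≠ 0 := by nlinarith [sq_nonneg y]
    have hr' : 3 - y ^ 2 ≠ 0 := by nlinarith [sq_nonneg y]
    have h1 : HasDerivAt (fun y : ℝ => 1 - y ^ 2 / 3) (-(2 * y / 3)) y := by
      simpa using ((hasDerivAt_pow 2 y).div_const 3).const_sub 1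
    have := (((hasDerivAt_id y).const_mul 2).add ((hasDerivAt_id y).mul (h1.log hr))).sub
      (hasDerivAt_identricAux hy.1 hy.2)
    refine this.congr_deriv ?_
    rw [show 1 - y ^ 2 / 3 = (3 - y ^ 2) / 3 by ring]
    simp only [id]
    field_simp
    ring
  have hmono : StrictMonoOn φ (Set.Ico 0 1) := by
    apply strictMonoOn_of_deriv_pos (convex_Ico 0 1)
    · exact fun y hy => (hd y hy).continuousAt.continuousWithinAt
    · rw [interior_Ico]
      intro y hy
      have hy' : y ∈ Set.Ico (0 : ℝ) 1 := ⟨hy.1.le, hy.2⟩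
      rw [(hd y hy').deriv]
      have hq := hpos y hy'
      have hr : 0 < 1 - y ^ 2 / 3 := by nlinarith [sq_nonneg y]
      have hr' : 0 < 3 - y ^ 2 := by linarith
      have hne : (1 - y ^ 2) / (1 - y ^ 2 / 3) ≠ 1 := by
        rw [Ne, div_eq_one_iff_eq hr.ne']
        nlinarith [hy.1, pow_pos hy.1 2]
      have := Real.log_lt_sub_one_of_pos (div_pos hq hr) hne
      rw [Real.log_div hq.ne' hr.ne'] at this
      have he : (1 - y ^ 2) / (1 - y ^ 2 / 3) - 1 = -(2 * y ^ 2 / (3 - y ^ 2)) := by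
        rw [show 1 - y ^ 2 / 3 = (3 - y ^ 2) / 3 by ring]
        field_simp
        ring
      linarith
  have := hmono (Set.left_mem_Ico.2 one_pos) ⟨hx.le, hx1⟩ hx
  have h0 : φ 0 = 0 := by simp [hφ, identricAux]
  rw [h0] at this
  simp only [hφ] at this
  linarith

theorem le_identricAux {c x : ℝ} (hx : 0 ≤ x) (hx1 : x < 1) (hc : 1 ≤ 3 * c * (1 - x ^ 2)) :
    2 * x - c * x ^ 3 ≤ identricAux x := by
  have hd : ∀ y ∈ Set.Icc 0 x, HasDerivAt (fun y => identricAux y - (2 * y - c * y ^ 3))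
      (Real.log (1 - y ^ 2) + 3 * c * y ^ 2) y := by
    intro y hy
    have := (hasDerivAt_identricAux hy.1 (hy.2.trans_lt hx1)).sub
      (((hasDerivAt_id y).const_mul 2).sub ((hasDerivAt_pow 3 y).const_mul c))
    refine this.congr_deriv ?_
    push_cast
    ring
  have hmono : MonotoneOn (fun y => identricAux y - (2 * y - c * y ^ 3)) (Set.Icc 0 x) := by
    apply monotoneOn_of_deriv_nonneg (convex_Icc 0 x)
    · exact fun y hy => (hd y hy).continuousAt.continuousWithinAt
    · exact fun y hy => (hd y (interior_subset hy)).differentiableAt.differentiableWithinAt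
    · intro y hy
      have hy' := interior_subset hy
      rw [(hd y hy').deriv]
      have hyx : y ^ 2 ≤ x ^ 2 := pow_le_pow_left₀ hy'.1 hy'.2 2
      have hx2 : x ^ 2 < 1 := by nlinarith
      have hq : 0 < 1 - y ^ 2 := by linarith
      have hc0 : 0 < c := by
        by_contra! h
        nlinarith
      have hinv : (1 - y ^ 2)⁻¹ ≤ 3 * c := by
        rw [inv_le_iff_one_le_mul₀ hq]
        nlinarith
      have hlog := Real.one_sub_inv_le_log_of_pos hq
      have he : 1 - (1 - y ^ 2)⁻¹ = -(y ^ 2 * (1 - y ^ 2)⁻¹) := by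
        field_simp
        ring
      nlinarith [sq_nonneg y]
  have := hmono (Set.left_mem_Icc.2 hx) (Set.right_mem_Icc.2 hx) hx
  simp only [identricAux] at this ⊢
  norm_num at this
  linarith

theorem half_sub_le_iff {s t : ℝ} (hs : 0 < s) (ht : t ≤ 1 / 2) :
    1 / 2 - 1 / (2 * √(3 * s)) ≤ t ↔ 3 * (s * (1 - 2 * t) ^ 2) ≤ 1 := by
  have hr : 0 < √(3 * s) := Real.sqrt_pos.2 (by positivity)
  have hsq : √(3 * s) ^ 2 = 3 * s := Real.sq_sqrt (by positivity)
  have h0 : 0 ≤ (1 - 2 * t) * √(3 * s) := mul_nonneg (by linarith) hr.le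
  have hsq' : 3 * (s * (1 - 2 * t) ^ 2) = ((1 - 2 * t) * √(3 * s)) ^ 2 := by
    rw [mul_pow, hsq]
    ring
  rw [hsq', sq_le_one_iff₀ h0, ← le_div_iff₀ hr]
  have : 1 / (2 * √(3 * s)) = 1 / √(3 * s) / 2 := by
    rw [div_div, mul_comm]
  rw [this]
  constructor <;> intro h <;> linarith

theorem I_lt_Q_of_lt {s t a b : ℝ} (hs : 1 ≤ s) (ht : 0 ≤ t) (ht1 : t ≤ 1 / 2)
    (hst : 3 * (s * (1 - 2 * t) ^ 2) ≤ 1) (hb : 0 < b) (hab : b < a) :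
    I a b < Q t s a b := by
  have hm : 0 < (a + b) / 2 := by linarith
  have hx : 0 < (a - b) / (a + b) := div_pos (by linarith) (by linarith)
  have hx1 : (a - b) / (a + b) < 1 := (div_lt_one (by linarith)).2 (by linarith)
  have hne : a + b ≠ 0 := by linarith
  have ea : a = (a + b) / 2 * (1 + (a - b) / (a + b)) := by
    field_simp
    ring
  have eb : b = (a + b) / 2 * (1 - (a - b) / (a + b)) := by
    field_simp
    ring
  generalize (a + b) / 2 = m at *
  generalize (a - b) / (a + b) = x at *
  rw [ea, eb, I_lt_Q_iff ht ht1 hm hx hx1]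
  refine (identricAux_lt hx hx1).trans_le ?_
  gcongr
  have hx2 : x ^ 2 < 1 := by nlinarith
  have hu : 3 * (1 - 2 * t) ^ 2 ≤ 1 := by nlinarith [sq_nonneg (1 - 2 * t)]
  have hw : 0 < 1 - (1 - 2 * t) ^ 2 * x ^ 2 := by nlinarith [sq_nonneg x]
  rw [← Real.log_rpow hw]
  apply Real.log_le_log (by linarith)
  have := one_add_mul_self_le_rpow_one_add (s := -((1 - 2 * t) ^ 2 * x ^ 2)) (by linarith) hs
  rw [← sub_eq_add_neg] at this
  nlinarith [sq_nonneg x]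

theorem stmt_1 (s t : ℝ) (hs : 1 ≤ s) (ht : t ∈ Set.Icc (0:ℝ) (1/2)) :
    (∀ a b : ℝ, 0 < a → 0 < b → a ≠ b → I a b < Q t s a b) ↔
      1/2 - 1 / (2 * Real.sqrt (3 * s)) ≤ t := by
  obtain ⟨ht0, ht1⟩ := ht
  rw [half_sub_le_iff (by linarith) ht1]
  constructor
  · intro hIQ
    by_contra! hc
    set c := s * (1 - 2 * t) ^ 2 with hcdef
    have hc0 : 0 < 3 * c := by linarith
    obtain ⟨x, hx, hx1, hcx⟩ : ∃ x : ℝ, 0 < x ∧ x < 1 ∧ 1 ≤ 3 * c * (1 - x ^ 2) := by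
      have hi : 0 < 1 / (3 * c) := by positivity
      have hi1 : 1 / (3 * c) < 1 := (div_lt_one hc0).2 hc
      refine ⟨1 - 1 / (3 * c), by linarith, by linarith, ?_⟩
      rw [← div_le_iff₀' hc0]
      nlinarith
    have hlt := (I_lt_Q_iff (s := s) ht0 ht1 one_pos hx hx1).1
      (hIQ _ _ (by linarith) (by linarith) (by linarith))
    have hle := le_identricAux hx.le hx1 hcx
    have hw : 0 < 1 - (1 - 2 * t) ^ 2 * x ^ 2 := by
      have hu : (1 - 2 * t) ^ 2 ≤ 1 := by nlinarith
      have hx2 : x ^ 2 < 1 := by nlinarith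
      nlinarith [sq_nonneg x]
    have hlog := Real.log_le_sub_one_of_pos hw
    have : x * (s * Real.log (1 - (1 - 2 * t) ^ 2 * x ^ 2)) ≤
        x * (s * (1 - (1 - 2 * t) ^ 2 * x ^ 2 - 1)) := by gcongr
    have he : x * (s * (1 - (1 - 2 * t) ^ 2 * x ^ 2 - 1)) = -(c * x ^ 3) := by
      rw [hcdef]
      ring
    linarith
  · intro hst a b ha hb hab
    rcases lt_or_gt_of_ne hab with hlt | hlt
    · rw [I_comm ha hb, Q_comm]
      exact I_lt_Q_of_lt hs ht0 ht1 hst ha hlt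
    · exact I_lt_Q_of_lt hs ht0 ht1 hst hb hlt
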